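/- Let E be a ℤ-graded vector space equipped with an associative product ∧ satisfying X∧Y ∈ E_{i+j+2} and X∧Y = (−1)^{(i+2)(j+2)} Y∧X for homogeneous X ∈ E_i, Y ∈ E_j (i.e. a graded commutative associative algebra structure on E[2]). If D_1 is a multi-derivation symmetric vector valued d_1-form and D_2 is a multi-derivation symmetric vector valued d_2-form on E, then [D_1,D_2]_RN is a multi-derivation symmetric vector valued (d_1+d_2−1)-form; consequently the multi-derivations form a graded Lie subalgebra of the symmetric vector valued forms with the Richardson–Nijenhuis bracket. -/

import Mathlib

open scoped DirectSum
open Classical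

noncomputable section

namespace RN

section Core

variable (𝕜 : Type) [Field 𝕜] [CharZero 𝕜]
variable (E : ℤ → Type) [∀ i, AddCommGroup (E i)] [∀ i, Module 𝕜 (E i)]

/-- Raw vector-valued forms on the graded vector space `E`: for every arity `n` and every
vector of (input) degrees `ι`, a function on homogeneous tuples with values in the total
graded space `⨁ i, E i`. -/
abbrev RawForm : Type :=
  ∀ n : ℕ, ∀ ι : Fin n → ℤ, (∀ j, E (ι j)) → ⨁ i, E i

/-- Multilinearity (in each slot, on homogeneous arguments). -/
def IsMultilin (F : RawForm E) : Prop :=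
  ∀ (n : ℕ) (ι : Fin n → ℤ) (x : ∀ j, E (ι j)) (j : Fin n) (a b : E (ι j)) (c : 𝕜),
    F n ι (Function.update x j (a + b)) =
        F n ι (Function.update x j a) + F n ι (Function.update x j b) ∧
      F n ι (Function.update x j (c • a)) = c • F n ι (Function.update x j a)

/-- Graded symmetry: swapping two adjacent homogeneous arguments multiplies the value
by the Koszul sign `(-1)^{|X||Y|}`. -/
def IsGradedSym (F : RawForm E) : Prop :=
  ∀ (n : ℕ) (ι : Fin n → ℤ) (x : ∀ j, E (ι j)) (p q : Fin n), (p : ℕ) + 1 = (q : ℕ) →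
    F n (fun j => ι (Equiv.swap p q j)) (fun j => x (Equiv.swap p q j)) =
      ((-1 : 𝕜) ^ (ι p * ι q)) • F n ι x

/-- `F` has degree `d`: its value on homogeneous arguments of degrees `ι` is homogeneous
of degree `(∑ j, ι j) + d`. -/
def IsOfDeg (d : ℤ) (F : RawForm E) : Prop :=
  ∀ (n : ℕ) (ι : Fin n → ℤ) (x : ∀ j, E (ι j)) (m : ℤ),
    m ≠ (∑ j, ι j) + d → F n ι x m = 0

/-- Symmetric vector valued form of degree `d`. -/
def IsSVF (d : ℤ) (F : RawForm E) : Prop :=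
  IsMultilin 𝕜 E F ∧ IsGradedSym 𝕜 E F ∧ IsOfDeg E d F

/-- `F` is (concentrated in) a `k`-form. -/
def IsArity (k : ℕ) (F : RawForm E) : Prop :=
  ∀ n, n ≠ k → ∀ (ι : Fin n → ℤ) (x : ∀ j, E (ι j)), F n ι x = 0

/-- `F` has no 0-form (curvature) component. -/
def NoCurv (F : RawForm E) : Prop :=
  ∀ (ι : Fin 0 → ℤ) (x : ∀ j, E (ι j)), F 0 ι x = 0

/-- `(k, n-k)`-shuffles of `Fin n`. -/
def IsShuffle (k : ℕ) {n : ℕ} (σ : Equiv.Perm (Fin n)) : Prop :=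
  ∀ i j : Fin n, i < j → ((j : ℕ) < k ∨ k ≤ (i : ℕ)) → σ i < σ j

/-- The Koszul sign of the rearrangement `(X_{σ(1)},…,X_{σ(n)})` of homogeneous elements
of degrees `ι`. -/
def koszulSign {n : ℕ} (ι : Fin n → ℤ) (σ : Equiv.Perm (Fin n)) : 𝕜 :=
  ∏ p ∈ Finset.univ.filter (fun p : Fin n × Fin n => p.1 < p.2 ∧ σ p.2 < σ p.1),
    (-1 : 𝕜) ^ (ι (σ p.1) * ι (σ p.2))

/-- Prepend a degree to a vector of degrees. -/
def dcons {n : ℕ} (m : ℤ) (rest : Fin n → ℤ) : Fin (n + 1) → ℤ :=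
  fun j => if h : (j : ℕ) = 0 then m else rest ⟨(j : ℕ) - 1, by have := j.isLt; omega⟩

/-- Prepend a homogeneous element to a tuple of homogeneous elements. -/
def dconsV {n : ℕ} {m : ℤ} {rest : Fin n → ℤ} (v : E m) (xs : ∀ i, E (rest i)) :
    ∀ j : Fin (n + 1), E (dcons m rest j) := fun j => by
  unfold dcons
  by_cases h : (j : ℕ) = 0
  · rw [dif_pos h]; exact v
  · rw [dif_neg h]; exact xs ⟨(j : ℕ) - 1, by have := j.isLt; omega⟩

/-- The insertion operator `ι_F G`, summing over shuffles with Koszul signs. -/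
def ins (F G : RawForm E) : RawForm E :=
  fun n ι x =>
    ∑ k : Fin (n + 1),
      ∑ σ ∈ Finset.univ.filter (fun σ : Equiv.Perm (Fin n) => IsShuffle (k : ℕ) σ),
        koszulSign 𝕜 ι σ •
          DFinsupp.sum
            (F (k : ℕ)
              (fun i => ι (σ ⟨(i : ℕ), by have h1 := i.isLt; have h2 := k.isLt; omega⟩))
              (fun i => x (σ ⟨(i : ℕ), by have h1 := i.isLt; have h2 := k.isLt; omega⟩)))
            (fun m v =>
              G (n - (k : ℕ) + 1)
                (dcons m
                  (fun i => ι (σ ⟨(k : ℕ) + (i : ℕ), by have h1 := i.isLt; have h2 := k.isLt; omega⟩)))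
                (dconsV E v
                  (fun i => x (σ ⟨(k : ℕ) + (i : ℕ), by have h1 := i.isLt; have h2 := k.isLt; omega⟩))))

/-- The Richardson–Nijenhuis bracket `[F,G]_RN = ι_F G - (-1)^{dK·dL} ι_G F` of forms
of degrees `dK` and `dL`. -/
def rnb (dK dL : ℤ) (F G : RawForm E) : RawForm E :=
  fun n ι x => ins 𝕜 E F G n ι x - ((-1 : 𝕜) ^ (dK * dL)) • ins 𝕜 E G F n ι x

/-- An element of the graded vector space, regarded as a vector valued 0-form. -/
def ofElem (v : ⨁ i, E i) : RawForm E := fun n _ _ => if n = 0 then v else 0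

/-- The Euler map `S(X) = -|X|·X`, a vector valued 1-form of degree 0. -/
def euler : RawForm E :=
  fun n ι x =>
    if h : n = 1 then
      (-(ι ⟨0, by omega⟩)) • DirectSum.of E (ι ⟨0, by omega⟩) (x ⟨0, by omega⟩)
    else 0

/-- The identity map of `E`, regarded as a vector valued 1-form of degree 0. -/
def idF : RawForm E :=
  fun n ι x =>
    if h : n = 1 then DirectSum.of E (ι ⟨0, by omega⟩) (x ⟨0, by omega⟩) else 0

/-- The arity-`k` component of a vector valued form. -/
def comp (F : RawForm E) (k : ℕ) : RawForm E :=
  fun n ι x => if n = k then F n ι x else 0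

end Core

/-- Append a degree at the end of a vector of degrees. -/
def snD {dm : ℕ} (ι' : Fin dm → ℤ) (c : ℤ) : Fin (dm + 1) → ℤ :=
  fun j => if h : (j : ℕ) < dm then ι' ⟨(j : ℕ), h⟩ else c

/-- Append a homogeneous element at the end of a tuple of homogeneous elements. -/
def snV (E : ℤ → Type) [∀ i, AddCommGroup (E i)] {dm : ℕ} {ι' : Fin dm → ℤ} {c : ℤ}
    (xs : ∀ i, E (ι' i)) (v : E c) : ∀ j : Fin (dm + 1), E (snD ι' c j) := fun j => by
  unfold snD
  by_cases h : (j : ℕ) < dm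
  · rw [dif_pos h]; exact xs ⟨(j : ℕ), h⟩
  · rw [dif_neg h]; exact v

/-- The product is bilinear. -/
def IsMulBilin (𝕜 : Type) [Field 𝕜] [CharZero 𝕜]
    (E : ℤ → Type) [∀ i, AddCommGroup (E i)] [∀ i, Module 𝕜 (E i)]
    (mul : (⨁ i, E i) → (⨁ i, E i) → ⨁ i, E i) : Prop :=
  ∀ (a b c : ⨁ i, E i) (r : 𝕜),
    mul (a + b) c = mul a c + mul b c ∧ mul c (a + b) = mul c a + mul c b ∧
      mul (r • a) c = r • mul a c ∧ mul c (r • a) = r • mul c a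

/-- The product maps `E_i × E_j` to `E_{i+j+2}` (i.e., it is a graded commutative algebra
structure on `E[2]`). -/
def IsMulGraded (E : ℤ → Type) [∀ i, AddCommGroup (E i)]
    (mul : (⨁ i, E i) → (⨁ i, E i) → ⨁ i, E i) : Prop :=
  ∀ (i j : ℤ) (v : E i) (w : E j) (m : ℤ), m ≠ i + j + 2 →
    mul (DirectSum.of E i v) (DirectSum.of E j w) m = 0

/-- Associativity of the product. -/
def IsMulAssoc (E : ℤ → Type) [∀ i, AddCommGroup (E i)]
    (mul : (⨁ i, E i) → (⨁ i, E i) → ⨁ i, E i) : Prop :=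
  ∀ a b c : ⨁ i, E i, mul (mul a b) c = mul a (mul b c)

/-- Graded commutativity for the shifted degrees: `X∧Y = (-1)^{(i+2)(j+2)} Y∧X`. -/
def IsMulComm (𝕜 : Type) [Field 𝕜] [CharZero 𝕜]
    (E : ℤ → Type) [∀ i, AddCommGroup (E i)] [∀ i, Module 𝕜 (E i)]
    (mul : (⨁ i, E i) → (⨁ i, E i) → ⨁ i, E i) : Prop :=
  ∀ (i j : ℤ) (v : E i) (w : E j),
    mul (DirectSum.of E i v) (DirectSum.of E j w) =
      ((-1 : 𝕜) ^ ((i + 2) * (j + 2))) • mul (DirectSum.of E j w) (DirectSum.of E i v)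

/-- `F` is a multi-derivation: Leibniz rule in the last argument with the Koszul sign for
the shifted degrees `∥X∥ = |X| + 2`. -/
def IsMultiDeriv (𝕜 : Type) [Field 𝕜] [CharZero 𝕜]
    (E : ℤ → Type) [∀ i, AddCommGroup (E i)] [∀ i, Module 𝕜 (E i)]
    (mul : (⨁ i, E i) → (⨁ i, E i) → ⨁ i, E i) (F : RawForm E) : Prop :=
  ∀ (dm : ℕ) (ι' : Fin dm → ℤ) (a b : ℤ) (xs : ∀ j, E (ι' j)) (Y : E a) (Z : E b),
    F (dm + 1) (snD ι' (a + b + 2))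
        (snV E xs ((mul (DirectSum.of E a Y) (DirectSum.of E b Z)) (a + b + 2))) =
      mul (F (dm + 1) (snD ι' a) (snV E xs Y)) (DirectSum.of E b Z) +
        ((-1 : 𝕜) ^ ((a + 2) * (b + 2))) •
          mul (F (dm + 1) (snD ι' b) (snV E xs Z)) (DirectSum.of E a Y)

/-- The Koszul sign `(-1)^{ab}` of two integers. -/
def sgn (𝕜 : Type) [Field 𝕜] (a b : ℤ) : 𝕜 := (-1 : 𝕜) ^ (a * b)

/-- A homogeneous element together with its degree. -/
abbrev Homog (E : ℤ → Type) : Type := Σ i, E i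

/-- The total degree of a list of homogeneous elements. -/
def totalDeg {E : ℤ → Type} (l : List (Homog E)) : ℤ := (l.map Sigma.fst).sum

section Sign

variable {𝕜 : Type} [Field 𝕜]

theorem neg_one_zpow_congr {a b : ℤ} (h : (a : ZMod 2) = b) : (-1 : 𝕜) ^ a = (-1) ^ b := by
  have hab : Even (a - b) := by
    rw [← ZMod.intCast_eq_zero_iff_even, Int.cast_sub, h, sub_self]
  have : a = (a - b) + b := by ring
  rw [this, zpow_add₀ (by simp), hab.neg_one_zpow, one_mul]

theorem sgn_comm (a b : ℤ) : sgn 𝕜 a b = sgn 𝕜 b a := by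
  simp only [sgn, mul_comm]

theorem sgn_add_left (a b c : ℤ) : sgn 𝕜 (a + b) c = sgn 𝕜 a c * sgn 𝕜 b c := by
  simp only [sgn, add_mul, zpow_add₀ (neg_ne_zero.2 one_ne_zero : (-1 : 𝕜) ≠ 0)]

theorem sgn_add_right (a b c : ℤ) : sgn 𝕜 c (a + b) = sgn 𝕜 c a * sgn 𝕜 c b := by
  simp only [sgn_comm c, sgn_add_left]

theorem sgn_zero_right (a : ℤ) : sgn 𝕜 a 0 = 1 := by simp [sgn]

theorem sgn_mul_self (a b : ℤ) : sgn 𝕜 a b * sgn 𝕜 a b = 1 := by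
  rw [sgn, ← zpow_add₀ (by simp)]
  exact Even.neg_one_zpow ⟨_, rfl⟩

theorem sgn_two_left (a : ℤ) : sgn 𝕜 2 a = 1 := Even.neg_one_zpow (by simp)

theorem sgn_two_right (a : ℤ) : sgn 𝕜 a 2 = 1 := Even.neg_one_zpow (by simp)

theorem sgn_sum_right {n : ℕ} (a : ℤ) (g : Fin n → ℤ) :
    sgn 𝕜 a (∑ j, g j) = ∏ j, sgn 𝕜 a (g j) := by
  induction n with
  | zero => simp [sgn]
  | succ n ih => rw [Fin.sum_univ_succ, Fin.prod_univ_succ, sgn_add_right, ih]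

variable {E : ℤ → Type}

@[simp] theorem totalDeg_nil : totalDeg ([] : List (Homog E)) = 0 := rfl

@[simp] theorem totalDeg_cons (x : Homog E) (l : List (Homog E)) :
    totalDeg (x :: l) = x.1 + totalDeg l := by simp [totalDeg]

@[simp] theorem totalDeg_append (l l' : List (Homog E)) :
    totalDeg (l ++ l') = totalDeg l + totalDeg l' := by simp [totalDeg]

theorem totalDeg_filter {n : ℕ} (f : Fin n → Homog E) (b : Fin n → Bool) :
    totalDeg (((List.finRange n).filter b).map f) = ∑ j, if b j then (f j).1 else 0 := by
  rw [Fin.sum_univ_def, totalDeg]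
  induction List.finRange n with
  | nil => rfl
  | cons i l ih => cases h : b i <;> simp_all

end Sign

section UnshuffleSum

variable (𝕜 : Type) [Field 𝕜] {E : ℤ → Type} {V W : Type} [AddCommGroup V] [Module 𝕜 V]
  [AddCommGroup W] [Module 𝕜 W]

/-- The sum of `φ I J` over all ways to split a list into complementary sublists `I` and `J`,
weighted by the Koszul sign of moving `I` to the front. -/
def unshuffleSum : (List (Homog E) → List (Homog E) → V) → List (Homog E) → V
  | φ, [] => φ [] []
  | φ, x :: l => unshuffleSum (fun I J => φ (x :: I) J) l +
      unshuffleSum (fun I J => sgn 𝕜 x.1 (totalDeg I) • φ I (x :: J)) l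

variable {𝕜}

theorem unshuffleSum_add (φ ψ : List (Homog E) → List (Homog E) → V) (l : List (Homog E)) :
    unshuffleSum 𝕜 (fun I J => φ I J + ψ I J) l = unshuffleSum 𝕜 φ l + unshuffleSum 𝕜 ψ l := by
  induction l generalizing φ ψ with
  | nil => rfl
  | cons x l ih => simp only [unshuffleSum, smul_add, ih]; abel

theorem map_unshuffleSum (T : V →ₗ[𝕜] W) (φ : List (Homog E) → List (Homog E) → V)
    (l : List (Homog E)) :
    T (unshuffleSum 𝕜 φ l) = unshuffleSum 𝕜 (fun I J => T (φ I J)) l := by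
  induction l generalizing φ with
  | nil => rfl
  | cons x l ih => simp only [unshuffleSum, map_add, ih, map_smul]

theorem unshuffleSum_smul (c : 𝕜) (φ : List (Homog E) → List (Homog E) → V)
    (l : List (Homog E)) :
    unshuffleSum 𝕜 (fun I J => c • φ I J) l = c • unshuffleSum 𝕜 φ l :=
  (map_unshuffleSum (LinearMap.lsmul 𝕜 V c) φ l).symm

theorem unshuffleSum_flip (φ : List (Homog E) → List (Homog E) → V) (l : List (Homog E)) :
    unshuffleSum 𝕜 (fun I J => sgn 𝕜 (totalDeg I) (totalDeg J) • φ J I) l =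
      unshuffleSum 𝕜 φ l := by
  induction l generalizing φ with
  | nil => simp [unshuffleSum, sgn]
  | cons x l ih =>
    rw [unshuffleSum, unshuffleSum, ← ih (fun I J => φ (x :: I) J),
      ← ih (fun I J => sgn 𝕜 x.1 (totalDeg I) • φ I (x :: J)), add_comm]
    congr 2 <;> funext I J
    · rw [smul_smul, totalDeg_cons, sgn_add_right, ← mul_assoc, sgn_comm x.1,
        sgn_mul_self, one_mul]
    · rw [smul_smul, totalDeg_cons, sgn_add_left, mul_comm]

theorem unshuffleSum_concat (φ : List (Homog E) → List (Homog E) → V) (l : List (Homog E))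
    (z : Homog E) :
    unshuffleSum 𝕜 φ (l ++ [z]) = unshuffleSum 𝕜 (fun I J => φ I (J ++ [z])) l +
      unshuffleSum 𝕜 (fun I J => sgn 𝕜 z.1 (totalDeg J) • φ (I ++ [z]) J) l := by
  induction l generalizing φ with
  | nil => simp [unshuffleSum, sgn, add_comm]
  | cons x l ih =>
    simp only [List.cons_append, unshuffleSum, ih, smul_smul, totalDeg_cons, totalDeg_append,
      totalDeg_nil, add_zero]
    have h : ∀ I J : List (Homog E), sgn 𝕜 z.1 (totalDeg J) * sgn 𝕜 x.1 (totalDeg I + z.1) =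
        sgn 𝕜 x.1 (totalDeg I) * sgn 𝕜 z.1 (x.1 + totalDeg J) := fun I J => by
      rw [sgn_add_right, sgn_add_right, sgn_comm z.1 x.1]; ring
    simp only [h]
    abel

/-- Graded symmetry of a function of lists of homogeneous elements. -/
def ListSym (𝕜 : Type) [Field 𝕜] [Module 𝕜 V] (F : List (Homog E) → V) : Prop :=
  ∀ (u w : List (Homog E)) (x y : Homog E),
    F (u ++ y :: x :: w) = sgn 𝕜 x.1 y.1 • F (u ++ x :: y :: w)

theorem ListSym.cons_eq_concat {F : List (Homog E) → V} (hs : ListSym 𝕜 F) (x : Homog E)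
    (l : List (Homog E)) :
    F (x :: l) = sgn 𝕜 x.1 (totalDeg l) • F (l ++ [x]) := by
  suffices ∀ u, F (u ++ x :: l) = sgn 𝕜 x.1 (totalDeg l) • F (u ++ l ++ [x]) from this []
  induction l with
  | nil => simp [sgn]
  | cons y l ih =>
    intro u
    have := ih (u ++ [y])
    simp only [List.append_assoc, List.cons_append, List.nil_append] at this
    rw [hs, this, smul_smul, totalDeg_cons, sgn_add_right, sgn_comm y.1]
    simp

theorem ListSym.unshuffleSum {φ : List (Homog E) → List (Homog E) → V}
    (hl : ∀ J, ListSym 𝕜 (fun I => φ I J)) (hr : ∀ I, ListSym 𝕜 (φ I)) :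
    ListSym 𝕜 (unshuffleSum 𝕜 φ) := by
  intro u w x y
  induction u generalizing φ with
  | nil =>
    have h1 := fun I J => hl J [] I x y
    have h2 := fun I J => hr I [] J x y
    simp only [List.nil_append] at h1 h2
    simp only [List.nil_append, RN.unshuffleSum, totalDeg_cons, h1, h2, smul_smul, smul_add,
      ← unshuffleSum_smul]
    have e1 : ∀ I : List (Homog E), sgn 𝕜 y.1 (x.1 + totalDeg I) =
        sgn 𝕜 x.1 y.1 * sgn 𝕜 y.1 (totalDeg I) := fun I => by rw [sgn_add_right, sgn_comm y.1]
    have e2 : ∀ I : List (Homog E), sgn 𝕜 x.1 y.1 * sgn 𝕜 x.1 (y.1 + totalDeg I) =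
        sgn 𝕜 x.1 (totalDeg I) := fun I => by
      rw [sgn_add_right, ← mul_assoc, sgn_mul_self, one_mul]
    have e3 : ∀ I : List (Homog E), sgn 𝕜 x.1 (totalDeg I) * (sgn 𝕜 y.1 (totalDeg I) *
        sgn 𝕜 x.1 y.1) = sgn 𝕜 x.1 y.1 * (sgn 𝕜 y.1 (totalDeg I) * sgn 𝕜 x.1 (totalDeg I)) :=
      fun I => by ring
    simp only [e1, e2, e3]
    abel
  | cons z u ih =>
    simp only [List.cons_append, RN.unshuffleSum, smul_add]
    rw [ih (fun J u w x y => hl J (z :: u) w x y) (fun I => hr (z :: I)),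
      ih (fun J u w x y => ?_) (fun I u w x y => ?_)]
    · have := hl (z :: J) u w x y
      simp only at this
      simp only [this, totalDeg_append, totalDeg_cons, add_left_comm y.1 x.1, smul_smul,
        mul_comm]
    · have := hr I (z :: u) w x y
      simp only [List.cons_append] at this
      simp only [this, smul_smul, mul_comm]

/-- The sum over unshuffles of a list, indexed by the indicator `b` of the front sublist. -/
theorem unshuffleSum_ofFn {n : ℕ} (φ : List (Homog E) → List (Homog E) → V)
    (f : Fin n → Homog E) :
    unshuffleSum 𝕜 φ (List.ofFn f) = ∑ b : Fin n → Bool,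
      (∏ i, ∏ j, if i < j ∧ b i = false ∧ b j = true then sgn 𝕜 (f i).1 (f j).1 else 1) •
        φ (((List.finRange n).filter b).map f)
          (((List.finRange n).filter (fun i => !b i)).map f) := by
  induction n generalizing φ with
  | zero => simp [unshuffleSum]
  | succ n ih =>
    rw [List.ofFn_succ, unshuffleSum, ih, ih, ← (Fin.consEquiv fun _ => Bool).sum_comp,
      Fintype.sum_prod_type, Fintype.sum_bool]
    congr 1 <;> refine Finset.sum_congr rfl fun b _ => ?_
    · simp [Fin.prod_univ_succ, List.finRange_succ, List.filter_map, Function.comp_def,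
        Fin.consEquiv]
    · simp [Fin.prod_univ_succ, List.finRange_succ, List.filter_map, Function.comp_def,
        Fin.consEquiv]
      rw [totalDeg_filter (fun i => f i.succ), sgn_sum_right, smul_smul, mul_comm]
      congr 2
      refine Finset.prod_congr rfl fun j _ => ?_
      split_ifs <;> simp [sgn_zero_right]

end UnshuffleSum

section Shuffles

/-- The `k`-shuffle given by `σ` puts exactly the indices selected by this indicator first. -/
def frontIndicator (k : ℕ) {n : ℕ} (σ : Equiv.Perm (Fin n)) (i : Fin n) : Bool :=
  decide ((σ.symm i : ℕ) < k)

theorem IsShuffle.eq_sort {k n : ℕ} {σ : Equiv.Perm (Fin n)} (h : IsShuffle k σ) :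
    σ = Tuple.sort fun i => !frontIndicator k σ i := by
  rw [Tuple.eq_sort_iff]
  constructor
  · intro i j hij
    have : (i : ℕ) ≤ j := hij
    simp only [Function.comp, frontIndicator, Equiv.symm_apply_apply, Bool.le_iff_imp]
    simp only [Bool.not_eq_true', decide_eq_false_iff_not]
    omega
  · intro i j hij hf
    simp only [frontIndicator, Equiv.symm_apply_apply, Bool.not_inj_iff, decide_eq_decide] at hf
    refine h i j hij ?_
    omega

theorem IsShuffle.ofFn_front {k n : ℕ} {σ : Equiv.Perm (Fin n)} (h : IsShuffle k σ)
    (hk : k ≤ n) :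
    List.ofFn (fun i : Fin k => σ (Fin.castLE hk i)) =
      (List.finRange n).filter (frontIndicator k σ) := by
  have h1 : (List.ofFn (fun i : Fin k => σ (Fin.castLE hk i))).Pairwise (· < ·) :=
    List.pairwise_ofFn.2 fun i j hij => h _ _ hij (Or.inl (by simp))
  have h2 : ((List.finRange n).filter (frontIndicator k σ)).Pairwise (· < ·) :=
    (List.pairwise_lt_finRange n).filter _
  refine List.Perm.eq_of_pairwise (fun a b _ _ h h' => (lt_asymm h h').elim) h1 h2 ?_
  rw [List.perm_ext_iff_of_nodup (h1.imp ne_of_lt) (h2.imp ne_of_lt)]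
  intro a
  simp only [List.mem_ofFn, List.mem_filter, List.mem_finRange, true_and, frontIndicator,
    decide_eq_true_eq]
  constructor
  · rintro ⟨i, rfl⟩
    simp
  · intro ha
    exact ⟨⟨_, ha⟩, by simp [Fin.castLE]⟩

theorem IsShuffle.ofFn_back {k n : ℕ} {σ : Equiv.Perm (Fin n)} (h : IsShuffle k σ)
    (hk : k ≤ n) :
    List.ofFn (fun i : Fin (n - k) => σ ⟨k + i, by omega⟩) =
      (List.finRange n).filter (fun i => !frontIndicator k σ i) := by
  have h1 : (List.ofFn (fun i : Fin (n - k) => σ ⟨k + i, by omega⟩)).Pairwise (· < ·) :=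
    List.pairwise_ofFn.2 fun i j hij => h _ _ (by simpa using hij) (Or.inr (by simp))
  have h2 : ((List.finRange n).filter (fun i => !frontIndicator k σ i)).Pairwise (· < ·) :=
    (List.pairwise_lt_finRange n).filter _
  refine List.Perm.eq_of_pairwise (fun a b _ _ h h' => (lt_asymm h h').elim) h1 h2 ?_
  rw [List.perm_ext_iff_of_nodup (h1.imp ne_of_lt) (h2.imp ne_of_lt)]
  intro a
  simp only [List.mem_ofFn, List.mem_filter, List.mem_finRange, true_and, frontIndicator,
    Bool.not_eq_true', decide_eq_false_iff_not, not_lt]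
  constructor
  · rintro ⟨i, rfl⟩
    simp
  · intro ha
    refine ⟨⟨(σ.symm a : ℕ) - k, by omega⟩, ?_⟩
    rw [← Equiv.eq_symm_apply]
    ext
    simp only
    omega

theorem exists_shuffle {n : ℕ} (b : Fin n → Bool) :
    ∃ (k : ℕ) (_ : k ≤ n) (σ : Equiv.Perm (Fin n)), IsShuffle k σ ∧ frontIndicator k σ = b := by
  set σ := Tuple.sort fun i => !b i with hσ
  obtain ⟨hmono, hlt⟩ := Tuple.eq_sort_iff.1 hσ
  have hanti : ∀ i j, i ≤ j → b (σ j) = true → b (σ i) = true := fun i j hij hj => by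
    have := hmono hij
    simp only [Function.comp, Bool.le_iff_imp, Bool.not_eq_true'] at this
    by_contra hi
    simp [this (by simpa using hi)] at hj
  obtain ⟨k, hk, hkb⟩ : ∃ k, k ≤ n ∧ ∀ i : Fin n, b (σ i) = true ↔ (i : ℕ) < k := by
    by_cases hall : ∃ i, b (σ i) = false
    · obtain ⟨i, hi, hmin⟩ := WellFounded.has_min (wellFounded_lt (α := Fin n))
        {i | b (σ i) = false} hall
      refine ⟨i, i.2.le, fun j => ⟨fun hj => ?_, fun hj => ?_⟩⟩
      · by_contra hij
        simp [hanti i j (by simpa using hij) hj] at hi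
      · by_contra hbj
        exact hmin j (by simpa using hbj) hj
    · simp only [not_exists, Bool.not_eq_false] at hall
      exact ⟨n, le_rfl, fun i => by simp [hall]⟩
  refine ⟨k, hk, σ, fun i j hij h => hlt i j hij ?_, ?_⟩
  · have hij' : (i : ℕ) < j := hij
    rw [Bool.not_inj_iff, Bool.eq_iff_iff, hkb, hkb]
    omega
  · funext i
    rw [Bool.eq_iff_iff, frontIndicator, decide_eq_true_eq, ← hkb, Equiv.apply_symm_apply]

variable {𝕜 : Type} [Field 𝕜]

theorem koszulSign_eq_prod {k n : ℕ} {σ : Equiv.Perm (Fin n)} (h : IsShuffle k σ)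
    (ι : Fin n → ℤ) :
    koszulSign 𝕜 ι σ = ∏ i, ∏ j,
      if i < j ∧ frontIndicator k σ i = false ∧ frontIndicator k σ j = true
        then sgn 𝕜 (ι i) (ι j) else 1 := by
  rw [koszulSign, Finset.prod_filter, ← Finset.univ_product_univ, Finset.prod_product_right]
  conv_rhs => rw [← Equiv.prod_comp σ]
  refine Finset.prod_congr rfl fun i _ => ?_
  conv_rhs => rw [← Equiv.prod_comp σ]
  refine Finset.prod_congr rfl fun j _ => ?_
  rw [sgn_comm]
  simp only [sgn, frontIndicator, Equiv.symm_apply_apply, decide_eq_false_iff_not,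
    decide_eq_true_eq]
  congr 1
  rw [eq_iff_iff]
  constructor
  · rintro ⟨hji, hσ⟩
    refine ⟨hσ, ?_⟩
    have := mt (h j i hji) hσ.asymm
    omega
  · rintro ⟨hσ, hi, hj⟩
    exact ⟨Fin.lt_def.2 (by omega), hσ⟩

variable {E : ℤ → Type} {V : Type} [AddCommGroup V] [Module 𝕜 V]

theorem sum_shuffle_eq_unshuffleSum {n : ℕ} (φ : List (Homog E) → List (Homog E) → V)
    (f : Fin n → Homog E) :
    ∑ k : Fin (n + 1), ∑ σ ∈ Finset.univ.filter
        (fun σ : Equiv.Perm (Fin n) => IsShuffle (k : ℕ) σ),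
      koszulSign 𝕜 (fun i => (f i).1) σ •
        φ (List.ofFn fun i : Fin k => f (σ ⟨i, by have h1 := i.isLt; omega⟩))
          (List.ofFn fun i : Fin (n - k) =>
            f (σ ⟨k + i, by have h1 := i.isLt; omega⟩)) =
      unshuffleSum 𝕜 φ (List.ofFn f) := by
  rw [unshuffleSum_ofFn, Finset.sum_sigma']
  refine Finset.sum_bij (fun p _ => frontIndicator (p.1 : ℕ) p.2) (fun _ _ => Finset.mem_univ _)
    ?_ ?_ ?_
  · rintro ⟨k, σ⟩ hσ ⟨k', σ'⟩ hσ' heq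
    simp only [Finset.mem_sigma, Finset.mem_univ, Finset.mem_filter, true_and] at hσ hσ' heq
    have e1 := congrArg List.length (hσ.ofFn_front (Nat.lt_succ_iff.1 k.2))
    have e2 := congrArg List.length (hσ'.ofFn_front (Nat.lt_succ_iff.1 k'.2))
    rw [heq, ← e2, List.length_ofFn, List.length_ofFn] at e1
    have e3 := hσ.eq_sort
    rw [heq, ← hσ'.eq_sort] at e3
    rw [Fin.ext e1, e3]
  · intro b _
    obtain ⟨k, hk, σ, hσ, hb⟩ := exists_shuffle b
    exact ⟨⟨⟨k, by omega⟩, σ⟩, by simpa using hσ, hb⟩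
  · rintro ⟨k, σ⟩ hσ
    simp only [Finset.mem_sigma, Finset.mem_univ, Finset.mem_filter, true_and] at hσ
    have hk := Nat.lt_succ_iff.1 k.2
    simp only
    rw [koszulSign_eq_prod hσ, ← hσ.ofFn_front hk, ← hσ.ofFn_back hk, List.map_ofFn,
      List.map_ofFn]
    rfl

end Shuffles

section Lists

theorem ofFn_update {α : Type} {n : ℕ} (f : Fin n → α) (j : Fin n) (a : α) :
    List.ofFn (Function.update f j a) =
      (List.ofFn f).take j ++ a :: (List.ofFn f).drop (j + 1) := by
  have : List.ofFn (Function.update f j a) = (List.ofFn f).set j a := by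
    refine List.ext_getElem (by simp) fun i h1 h2 => ?_
    simp [List.getElem_set, Function.update_apply, Fin.ext_iff, eq_comm]
  rw [this, List.set_eq_take_append_cons_drop, if_pos (by simp)]

theorem ofFn_swap {α : Type} {n : ℕ} (f : Fin n → α) {p q : Fin n} (h : (p : ℕ) + 1 = q) :
    List.ofFn (fun i => f (Equiv.swap p q i)) =
      (List.ofFn f).take p ++ f q :: f p :: (List.ofFn f).drop (p + 2) := by
  refine List.ext_getElem (by simp; omega) fun i h1 h2 => ?_
  simp only [List.getElem_ofFn, List.getElem_append, List.getElem_cons, List.length_take,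
    List.length_ofFn, List.getElem_take, List.getElem_drop, Equiv.swap_apply_def, Fin.ext_iff]
  simp only [List.length_ofFn] at h1
  rcases lt_trichotomy i p with hi | hi | hi
  · rw [if_neg (by omega), if_neg (by omega), dif_pos (by omega)]
  · rw [if_pos hi, dif_neg (by omega), dif_pos (by omega)]
  · by_cases hq : i = q
    · rw [if_neg (by omega), if_pos hq, dif_neg (by omega), dif_neg (by omega),
        dif_pos (by omega)]
    · rw [if_neg (by omega), if_neg (by omega), dif_neg (by omega), dif_neg (by omega),
        dif_neg (by omega)]
      congr 2
      omega

theorem ofFn_eq_take_append_cons_cons {α : Type} {n : ℕ} (f : Fin n → α) {p q : Fin n}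
    (h : (p : ℕ) + 1 = q) :
    List.ofFn f = (List.ofFn f).take p ++ f p :: f q :: (List.ofFn f).drop (p + 2) := by
  have hp : (p : ℕ) < (List.ofFn f).length := by simp
  have hq : (p : ℕ) + 1 < (List.ofFn f).length := by simp [h]
  conv_lhs => rw [← List.take_append_drop p (List.ofFn f), List.drop_eq_getElem_cons hp,
    List.drop_eq_getElem_cons hq]
  simp only [List.getElem_ofFn, Fin.eta, h]
  simp only [add_assoc, Nat.reduceAdd, ← h]

theorem update_mk {E : ℤ → Type} {n : ℕ} (ι : Fin n → ℤ) (x : ∀ j, E (ι j)) (j : Fin n)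
    (a : E (ι j)) :
    (fun i => (⟨ι i, Function.update x j a i⟩ : Homog E)) =
      Function.update (fun i => ⟨ι i, x i⟩) j ⟨ι j, a⟩ := by
  funext i
  by_cases h : i = j
  · subst h; simp
  · simp [h]

variable {𝕜 : Type} [Field 𝕜]
variable {E : ℤ → Type} [∀ i, AddCommGroup (E i)] [∀ i, Module 𝕜 (E i)]

/-- A raw form, regarded as a function of lists of homogeneous elements. -/
def onList (F : RawForm E) (l : List (Homog E)) : ⨁ i, E i :=
  F l.length (fun i => (l.get i).1) (fun i => (l.get i).2)

theorem onList_ofFn (F : RawForm E) {n : ℕ} (f : Fin n → Homog E) :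
    onList F (List.ofFn f) = F n (fun i => (f i).1) (fun i => (f i).2) :=
  congrArg (fun p : Σ n, Fin n → Homog E => F p.1 (fun i => (p.2 i).1) (fun i => (p.2 i).2))
    (List.equivSigmaTuple.apply_symm_apply ⟨n, f⟩)

theorem eq_onList (F : RawForm E) {n : ℕ} (ι : Fin n → ℤ) (x : ∀ j, E (ι j)) :
    F n ι x = onList F (List.ofFn fun i => ⟨ι i, x i⟩) :=
  (onList_ofFn F fun i => ⟨ι i, x i⟩).symm

theorem apply_dcons (F : RawForm E) {n : ℕ} {m : ℤ} {ι : Fin n → ℤ} (v : E m)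
    (x : ∀ j, E (ι j)) :
    F (n + 1) (dcons m ι) (dconsV E v x) =
      onList F (⟨m, v⟩ :: List.ofFn fun i => ⟨ι i, x i⟩) := by
  rw [eq_onList F, List.ofFn_succ]
  rfl

theorem apply_snD (F : RawForm E) {n : ℕ} {c : ℤ} {ι : Fin n → ℤ} (x : ∀ j, E (ι j))
    (v : E c) :
    F (n + 1) (snD ι c) (snV E x v) =
      onList F ((List.ofFn fun i => ⟨ι i, x i⟩) ++ [⟨c, v⟩]) := by
  have hlt : ∀ j : Fin (n + 1), ∀ h : (j : ℕ) < n,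
      (⟨snD ι c j, snV E x v j⟩ : Homog E) = ⟨ι ⟨j, h⟩, x ⟨j, h⟩⟩ := fun j h =>
    Sigma.ext (by simp [snD, h]) (by simp only [snV, h, dite_true]; exact cast_heq _ _)
  have hge : ∀ j : Fin (n + 1), ¬ (j : ℕ) < n →
      (⟨snD ι c j, snV E x v j⟩ : Homog E) = ⟨c, v⟩ := fun j h =>
    Sigma.ext (by simp [snD, h]) (by simp only [snV, h, dite_false]; exact cast_heq _ _)
  rw [eq_onList F, List.ofFn_succ_last, hge _ (by simp)]
  congr 3
  funext i
  exact hlt _ (by simp)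

/-- Multilinearity of a function of lists of homogeneous elements. -/
def ListMultilin (𝕜 : Type) [Field 𝕜] {V : Type} [AddCommGroup V] [Module 𝕜 V]
    [∀ i, Module 𝕜 (E i)] (F : List (Homog E) → V) : Prop :=
  ∀ (u w : List (Homog E)) (i : ℤ) (a b : E i) (c : 𝕜),
    F (u ++ ⟨i, a + b⟩ :: w) = F (u ++ ⟨i, a⟩ :: w) + F (u ++ ⟨i, b⟩ :: w) ∧
      F (u ++ ⟨i, c • a⟩ :: w) = c • F (u ++ ⟨i, a⟩ :: w)

theorem isMultilin_iff (F : RawForm E) : IsMultilin 𝕜 E F ↔ ListMultilin 𝕜 (onList F) := by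
  constructor
  · intro h u w i a b c
    have key : ∀ {n : ℕ} (f : Fin n → Homog E) (j : Fin n), (f j).1 = i →
        onList F (List.ofFn (Function.update f j ⟨i, a + b⟩)) =
            onList F (List.ofFn (Function.update f j ⟨i, a⟩)) +
              onList F (List.ofFn (Function.update f j ⟨i, b⟩)) ∧
          onList F (List.ofFn (Function.update f j ⟨i, c • a⟩)) =
            c • onList F (List.ofFn (Function.update f j ⟨i, a⟩)) := by
      rintro n f j rfl
      have := h n (fun i => (f i).1) (fun i => (f i).2) j a b c
      simp only [eq_onList F, update_mk] at this
      exact this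
    have := key (u ++ ⟨i, a⟩ :: w).get ⟨u.length, by simp⟩ (by simp)
    simpa only [ofFn_update, List.ofFn_get, List.take_left, List.drop_append_of_le_length,
      List.drop_left, ← List.drop_drop, List.drop_succ_cons, List.drop_zero] using this
  · intro h n ι x j a b c
    simp only [eq_onList F, update_mk, ofFn_update]
    exact h _ _ _ a b c

theorem isGradedSym_iff (F : RawForm E) : IsGradedSym 𝕜 E F ↔ ListSym 𝕜 (onList F) := by
  constructor
  · intro h u w x y
    have e : List.ofFn (fun i => (u ++ x :: y :: w).get (Equiv.swap ⟨u.length, by simp⟩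
        ⟨u.length + 1, by simp⟩ i)) = u ++ y :: x :: w := by
      rw [ofFn_swap (u ++ x :: y :: w).get rfl, List.ofFn_get]
      simp [← List.drop_drop]
    have := h (u ++ x :: y :: w).length (fun i => ((u ++ x :: y :: w).get i).1)
      (fun i => ((u ++ x :: y :: w).get i).2) ⟨u.length, by simp⟩ ⟨u.length + 1, by simp⟩ rfl
    rw [eq_onList F, e] at this
    simpa [sgn, onList] using this
  · intro h n ι x p q hpq
    rw [eq_onList F, eq_onList F, ofFn_swap (fun i => (⟨ι i, x i⟩ : Homog E)) hpq, h, sgn,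
      ← ofFn_eq_take_append_cons_cons (fun i => (⟨ι i, x i⟩ : Homog E)) hpq]

/-- The Leibniz rule in the last entry for a function of lists of homogeneous elements. -/
def ListDeriv (𝕜 : Type) [Field 𝕜] [∀ i, Module 𝕜 (E i)]
    (mul : (⨁ i, E i) → (⨁ i, E i) → ⨁ i, E i) (F : List (Homog E) → ⨁ i, E i) : Prop :=
  ∀ (l : List (Homog E)) (a b : ℤ) (Y : E a) (Z : E b),
    F (l ++ [⟨a + b + 2, mul (DirectSum.of E a Y) (DirectSum.of E b Z) (a + b + 2)⟩]) =
      mul (F (l ++ [⟨a, Y⟩])) (DirectSum.of E b Z) +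
        sgn 𝕜 a b • mul (F (l ++ [⟨b, Z⟩])) (DirectSum.of E a Y)

theorem isMultiDeriv_iff [CharZero 𝕜] (mul : (⨁ i, E i) → (⨁ i, E i) → ⨁ i, E i) (F : RawForm E) :
    IsMultiDeriv 𝕜 E mul F ↔ ListDeriv 𝕜 mul (onList F) := by
  have hs : ∀ a b : ℤ, (-1 : 𝕜) ^ ((a + 2) * (b + 2)) = sgn 𝕜 a b := fun a b => by
    change sgn 𝕜 (a + 2) (b + 2) = _
    simp [sgn_add_left, sgn_add_right, sgn_two_left, sgn_two_right]
  constructor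
  · intro h l a b Y Z
    have := h l.length (fun i => (l.get i).1) a b (fun i => (l.get i).2) Y Z
    simpa [apply_snD, hs] using this
  · intro h n ι a b x Y Z
    simp only [apply_snD, hs]
    exact h _ a b Y Z

theorem IsOfDeg.onList {d : ℤ} {F : RawForm E} (h : IsOfDeg E d F) (l : List (Homog E)) {m : ℤ}
    (hm : m ≠ totalDeg l + d) : onList F l m = 0 := by
  refine h _ _ _ m ?_
  convert hm
  rw [totalDeg, ← List.sum_ofFn]
  congr 1
  refine List.ext_getElem (by simp) (by simp)

end Lists

section Insertion

variable {𝕜 : Type} [Field 𝕜]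
variable {E : ℤ → Type} [∀ i, AddCommGroup (E i)] [∀ i, Module 𝕜 (E i)]

/-- The linear extension of `v ↦ G (v, J)` to the total space. -/
def insertLin {G : List (Homog E) → ⨁ i, E i} (hG : ListMultilin 𝕜 G) (J : List (Homog E)) :
    (⨁ i, E i) →ₗ[𝕜] ⨁ i, E i :=
  DirectSum.toModule 𝕜 ℤ _ fun m =>
    { toFun := fun v => G (⟨m, v⟩ :: J)
      map_add' := fun a b => (hG [] J m a b 0).1
      map_smul' := fun c a => (hG [] J m a a c).2 }

section

variable {G : List (Homog E) → ⨁ i, E i} (hG : ListMultilin 𝕜 G)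

theorem insertLin_of (J : List (Homog E)) (m : ℤ) (v : E m) :
    insertLin hG J (DirectSum.of E m v) = G (⟨m, v⟩ :: J) :=
  DirectSum.toModule_lof 𝕜 m v

theorem insertLin_eq_sum (J : List (Homog E)) (v : ⨁ i, E i) :
    insertLin hG J v = DFinsupp.sum v fun m a => G (⟨m, a⟩ :: J) :=
  (DFinsupp.lsum_apply_apply ℕ _ v).trans (DFinsupp.sumAddHom_apply _ v)

theorem hom_ext {T T' : (⨁ i, E i) →ₗ[𝕜] ⨁ i, E i}
    (h : ∀ m (v : E m), T (DirectSum.of E m v) = T' (DirectSum.of E m v)) : T = T' :=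
  DirectSum.linearMap_ext 𝕜 fun m => LinearMap.ext fun v => h m v

theorem insertLin_sym (hs : ListSym 𝕜 G) (v : ⨁ i, E i) :
    ListSym 𝕜 fun J => insertLin hG J v := by
  intro u w x y
  refine LinearMap.congr_fun (f := insertLin hG _) (g := sgn 𝕜 x.1 y.1 • insertLin hG _)
    (hom_ext fun m a => ?_) v
  rw [LinearMap.smul_apply, insertLin_of, insertLin_of]
  exact hs (⟨m, a⟩ :: u) w x y

theorem insertLin_multilin (v : ⨁ i, E i) : ListMultilin 𝕜 fun J => insertLin hG J v := by
  intro u w i a b c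
  constructor
  · refine LinearMap.congr_fun (f := insertLin hG _) (g := insertLin hG _ + insertLin hG _)
      (hom_ext fun m v => ?_) v
    simp only [LinearMap.add_apply, insertLin_of]
    exact (hG (⟨m, v⟩ :: u) w i a b c).1
  · refine LinearMap.congr_fun (f := insertLin hG _) (g := c • insertLin hG _)
      (hom_ext fun m v => ?_) v
    simp only [LinearMap.smul_apply, insertLin_of]
    exact (hG (⟨m, v⟩ :: u) w i a b c).2

theorem ListMultilin.unshuffleSum {φ : List (Homog E) → List (Homog E) → ⨁ i, E i}
    (hl : ∀ J, ListMultilin 𝕜 (fun I => φ I J)) (hr : ∀ I, ListMultilin 𝕜 (φ I)) :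
    ListMultilin 𝕜 (unshuffleSum 𝕜 φ) := by
  intro u w i a b c
  induction u generalizing φ with
  | nil =>
    have h1 := fun I J => hl J [] I i a b c
    have h2 := fun I J => hr I [] J i a b c
    simp only [List.nil_append] at h1 h2
    simp only [List.nil_append, RN.unshuffleSum, fun I J => (h1 I J).1, fun I J => (h1 I J).2,
      fun I J => (h2 I J).1, fun I J => (h2 I J).2, smul_add, unshuffleSum_add,
      unshuffleSum_smul, smul_comm _ c]
    exact ⟨by abel, trivial⟩
  | cons z u ih =>
    obtain ⟨h1, h2⟩ := ih (φ := fun I J => φ (z :: I) J)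
      (fun J u w i a b c => hl J (z :: u) w i a b c) (fun I => hr (z :: I))
    obtain ⟨h3, h4⟩ := ih (φ := fun I J => sgn 𝕜 z.1 (totalDeg I) • φ I (z :: J))
      (fun J u w i a b c => by
        obtain ⟨h1, h2⟩ := hl (z :: J) u w i a b c
        simp only at h1 h2
        simp only [h1, h2, totalDeg_append, totalDeg_cons, smul_add, smul_comm _ c, and_self])
      (fun I u w i a b c => by
        obtain ⟨h1, h2⟩ := hr I (z :: u) w i a b c
        simp only [List.cons_append] at h1 h2
        simp only [h1, h2, smul_add, smul_comm _ c, and_self])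
    simp only [List.cons_append, RN.unshuffleSum, h1, h2, h3, h4, smul_add]
    exact ⟨by abel, trivial⟩

end

section Leibniz

variable {m : (⨁ i, E i) →ₗ[𝕜] (⨁ i, E i) →ₗ[𝕜] ⨁ i, E i}
  {G : List (Homog E) → ⨁ i, E i} (hG : ListMultilin 𝕜 G)

theorem insertLin_concat_mul (hd : ListDeriv 𝕜 (fun v w => m v w) G) (J : List (Homog E))
    (v : ⨁ i, E i) {a b : ℤ} (Y : E a) (Z : E b) :
    insertLin hG
        (J ++ [⟨a + b + 2, m (DirectSum.of E a Y) (DirectSum.of E b Z) (a + b + 2)⟩]) v =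
      m (insertLin hG (J ++ [⟨a, Y⟩]) v) (DirectSum.of E b Z) +
        sgn 𝕜 a b • m (insertLin hG (J ++ [⟨b, Z⟩]) v) (DirectSum.of E a Y) := by
  refine LinearMap.congr_fun (f := insertLin hG _)
    (g := m.flip (DirectSum.of E b Z) ∘ₗ insertLin hG _ +
      sgn 𝕜 a b • m.flip (DirectSum.of E a Y) ∘ₗ insertLin hG _) (hom_ext fun i v => ?_) v
  simp only [LinearMap.add_apply, LinearMap.smul_apply, LinearMap.comp_apply,
    LinearMap.flip_apply, insertLin_of]
  exact hd (⟨i, v⟩ :: J) a b Y Z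

theorem eq_of_apply_eq_zero {v : ⨁ i, E i} {d : ℤ} (h : ∀ k, k ≠ d → v k = 0) :
    v = DirectSum.of E d (v d) := by
  ext k
  by_cases hk : k = d
  · subst hk; simp
  · rw [h k hk, DirectSum.of_eq_of_ne _ _ _ hk]

theorem insertLin_mul (hs : ListSym 𝕜 G) (hd : ListDeriv 𝕜 (fun v w => m v w) G)
    (hgr : IsMulGraded E fun v w => m v w) (J : List (Homog E)) {α b : ℤ} {A : ⨁ i, E i}
    (hA : ∀ k, k ≠ α → A k = 0) (Z : E b) :
    insertLin hG J (m A (DirectSum.of E b Z)) =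
      sgn 𝕜 b (totalDeg J) • m (insertLin hG J A) (DirectSum.of E b Z) +
        (sgn 𝕜 (α + b) (totalDeg J) * sgn 𝕜 α b) • m (G (J ++ [⟨b, Z⟩])) A := by
  have hmul : m (DirectSum.of E α (A α)) (DirectSum.of E b Z) = _ :=
    eq_of_apply_eq_zero (hgr α b (A α) Z)
  rw [eq_of_apply_eq_zero hA, hmul, insertLin_of, hs.cons_eq_concat, hd, insertLin_of,
    hs.cons_eq_concat]
  simp only [map_smul, LinearMap.smul_apply, smul_add, smul_smul, sgn_add_left, sgn_two_left,
    mul_one]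
  congr 2
  ring

end Leibniz

theorem onList_ins (F G : RawForm E) (hG : ListMultilin 𝕜 (onList G)) (l : List (Homog E)) :
    onList (ins 𝕜 E F G) l = unshuffleSum 𝕜 (fun I J => insertLin hG J (onList F I)) l := by
  obtain ⟨n, f, rfl⟩ : ∃ (n : ℕ) (f : Fin n → Homog E), l = List.ofFn f :=
    ⟨_, l.get, (List.ofFn_get l).symm⟩
  rw [onList_ofFn, ← sum_shuffle_eq_unshuffleSum, ins]
  refine Finset.sum_congr rfl fun k _ => Finset.sum_congr rfl fun σ _ => ?_
  congr 1
  rw [insertLin_eq_sum, onList_ofFn]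
  congr 1
  funext i v
  rw [apply_dcons G]

theorem ins_isArity {F G : RawForm E} {p q : ℕ} (hF : IsArity E p F) (hG : IsArity E q G) :
    IsArity E (p + q - 1) (ins 𝕜 E F G) := by
  intro n hn ι x
  rw [ins]
  refine Finset.sum_eq_zero fun k _ => Finset.sum_eq_zero fun σ _ => ?_
  by_cases hk : (k : ℕ) = p
  · have : n - k + 1 ≠ q := by omega
    simp only [hG _ this, DFinsupp.sum, Finset.sum_const_zero, smul_zero]
  · rw [hF _ hk, DFinsupp.sum_zero_index, smul_zero]

end Insertion

section Bracket

variable {𝕜 : Type} [Field 𝕜]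
variable {E : ℤ → Type} [∀ i, AddCommGroup (E i)] [∀ i, Module 𝕜 (E i)]
variable (m : (⨁ i, E i) →ₗ[𝕜] (⨁ i, E i) →ₗ[𝕜] ⨁ i, E i)

/-- The defect of the Leibniz rule for the insertion of a form `F` of degree `d` into `G`. -/
def crossTerm (d : ℤ) (F G : List (Homog E) → ⨁ i, E i) {a b : ℤ} (Y : E a) (Z : E b)
    (I J : List (Homog E)) : ⨁ i, E i :=
  (sgn 𝕜 (totalDeg I + d) (totalDeg J) * sgn 𝕜 (totalDeg I + a + d) b) •
      m (G (J ++ [⟨b, Z⟩])) (F (I ++ [⟨a, Y⟩])) +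
    (sgn 𝕜 a b * (sgn 𝕜 (totalDeg I + d) (totalDeg J) * sgn 𝕜 (totalDeg I + b + d) a)) •
      m (G (J ++ [⟨a, Y⟩])) (F (I ++ [⟨b, Z⟩]))

variable {m}

theorem mul_comm_of_homogeneous
    (hcomm : ∀ (i j : ℤ) (v : E i) (w : E j), m (DirectSum.of E i v) (DirectSum.of E j w) =
      sgn 𝕜 i j • m (DirectSum.of E j w) (DirectSum.of E i v))
    {A B : ⨁ i, E i} {α β : ℤ} (hA : ∀ k, k ≠ α → A k = 0) (hB : ∀ k, k ≠ β → B k = 0) :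
    m A B = sgn 𝕜 α β • m B A := by
  rw [eq_of_apply_eq_zero hA, eq_of_apply_eq_zero hB, hcomm]

theorem crossTerm_flip
    (hcomm : ∀ (i j : ℤ) (v : E i) (w : E j), m (DirectSum.of E i v) (DirectSum.of E j w) =
      sgn 𝕜 i j • m (DirectSum.of E j w) (DirectSum.of E i v))
    {d e : ℤ} {F G : RawForm E} (hF : IsOfDeg E d F) (hG : IsOfDeg E e G) {a b : ℤ}
    (Y : E a) (Z : E b) (I J : List (Homog E)) :
    crossTerm m d (onList F) (onList G) Y Z I J = sgn 𝕜 d e •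
      sgn 𝕜 (totalDeg I) (totalDeg J) • crossTerm m e (onList G) (onList F) Y Z J I := by
  have hdeg : ∀ {δ : ℤ} {H : RawForm E}, IsOfDeg E δ H → ∀ (K : List (Homog E)) (c : ℤ)
      (X : E c) (k : ℤ), k ≠ totalDeg K + c + δ → onList H (K ++ [⟨c, X⟩]) k = 0 :=
    fun hH K c X k hk => hH.onList _ (by simpa using hk)
  rw [crossTerm, crossTerm, add_comm,
    mul_comm_of_homogeneous hcomm (hdeg hF I b Z) (hdeg hG J a Y),
    mul_comm_of_homogeneous hcomm (hdeg hF I a Y) (hdeg hG J b Z)]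
  simp only [smul_add, smul_smul]
  congr 2 <;>
  · simp only [sgn, ← zpow_add₀ (neg_ne_zero.2 one_ne_zero : (-1 : 𝕜) ≠ 0)]
    apply neg_one_zpow_congr
    push_cast
    grind

theorem onList_ins_concat_mul {d : ℤ} {F G : RawForm E} (hFd : IsOfDeg E d F)
    (hG : ListMultilin 𝕜 (onList G)) (hGs : ListSym 𝕜 (onList G))
    (hgr : IsMulGraded E fun v w => m v w)
    (hF' : ListDeriv 𝕜 (fun v w => m v w) (onList F))
    (hG' : ListDeriv 𝕜 (fun v w => m v w) (onList G)) (l : List (Homog E)) {a b : ℤ}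
    (Y : E a) (Z : E b) :
    onList (ins 𝕜 E F G)
        (l ++ [⟨a + b + 2, m (DirectSum.of E a Y) (DirectSum.of E b Z) (a + b + 2)⟩]) =
      m (onList (ins 𝕜 E F G) (l ++ [⟨a, Y⟩])) (DirectSum.of E b Z) +
        sgn 𝕜 a b • m (onList (ins 𝕜 E F G) (l ++ [⟨b, Z⟩])) (DirectSum.of E a Y) +
        unshuffleSum 𝕜 (crossTerm m d (onList F) (onList G) Y Z) l := by
  have hdeg : ∀ (K : List (Homog E)) (c : ℤ) (X : E c) (k : ℤ), k ≠ totalDeg K + c + d →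
      onList F (K ++ [⟨c, X⟩]) k = 0 :=
    fun K c X k hk => hFd.onList _ (by simpa using hk)
  have hmap : ∀ (φ : List (Homog E) → List (Homog E) → ⨁ i, E i) (B : ⨁ i, E i),
      m (unshuffleSum 𝕜 φ l) B = unshuffleSum 𝕜 (fun I J => m (φ I J) B) l :=
    fun φ B => map_unshuffleSum (m.flip B) φ l
  simp only [onList_ins F G hG, unshuffleSum_concat, ← unshuffleSum_add, hmap,
    ← unshuffleSum_smul]
  congr 1
  funext I J
  rw [insertLin_concat_mul hG hG', hF', map_add, map_smul,
    insertLin_mul hG hGs hG' hgr J (hdeg I a Y) Z, insertLin_mul hG hGs hG' hgr J (hdeg I b Z) Y,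
    crossTerm]
  have hsq : ∀ {p q r : ℤ}, ((p + q : ℤ) : ZMod 2) = r →
      sgn 𝕜 p (totalDeg J) * sgn 𝕜 q (totalDeg J) = sgn 𝕜 r (totalDeg J) := fun h => by
    rw [← sgn_add_left, sgn, sgn]
    exact neg_one_zpow_congr (by rw [Int.cast_mul, Int.cast_mul, h])
  have h2 : (2 : ZMod 2) = 0 := rfl
  have e1 : sgn 𝕜 (a + b + 2) (totalDeg J) * sgn 𝕜 b (totalDeg J) = sgn 𝕜 a (totalDeg J) :=
    hsq (by push_cast; linear_combination ((b : ZMod 2) + 1) * h2)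
  have e2 : sgn 𝕜 (a + b + 2) (totalDeg J) * sgn 𝕜 a (totalDeg J) = sgn 𝕜 b (totalDeg J) :=
    hsq (by push_cast; linear_combination ((a : ZMod 2) + 1) * h2)
  have e3 : sgn 𝕜 (a + b + 2) (totalDeg J) * sgn 𝕜 (totalDeg I + a + d + b) (totalDeg J) =
      sgn 𝕜 (totalDeg I + d) (totalDeg J) :=
    hsq (by push_cast; linear_combination ((a : ZMod 2) + b + 1) * h2)
  have e4 : sgn 𝕜 (a + b + 2) (totalDeg J) * sgn 𝕜 (totalDeg I + b + d + a) (totalDeg J) =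
      sgn 𝕜 (totalDeg I + d) (totalDeg J) :=
    hsq (by push_cast; linear_combination ((a : ZMod 2) + b + 1) * h2)
  have e3' := fun x => (mul_assoc _ _ x).symm.trans (congrArg (· * x) e3)
  have e4' := fun x => (mul_assoc _ _ x).symm.trans (congrArg (· * x) e4)
  simp only [map_add, map_smul, LinearMap.add_apply, LinearMap.smul_apply, smul_add, smul_smul,
    mul_left_comm (sgn 𝕜 (a + b + 2) (totalDeg J)) (sgn 𝕜 a b), e1, e2, e3', e4']
  module

theorem bracket_listDeriv {d e : ℤ} {F G : RawForm E}
    (hF : IsSVF 𝕜 E d F) (hG : IsSVF 𝕜 E e G)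
    (hgr : IsMulGraded E fun v w => m v w)
    (hcomm : ∀ (i j : ℤ) (v : E i) (w : E j), m (DirectSum.of E i v) (DirectSum.of E j w) =
      sgn 𝕜 i j • m (DirectSum.of E j w) (DirectSum.of E i v))
    (hF' : ListDeriv 𝕜 (fun v w => m v w) (onList F))
    (hG' : ListDeriv 𝕜 (fun v w => m v w) (onList G)) :
    ListDeriv 𝕜 (fun v w => m v w) (onList (rnb 𝕜 E d e F G)) := by
  intro l a b Y Z
  have hr : ∀ l, onList (rnb 𝕜 E d e F G) l =
      onList (ins 𝕜 E F G) l - sgn 𝕜 d e • onList (ins 𝕜 E G F) l := fun l => rfl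
  have hcross : unshuffleSum 𝕜 (crossTerm m d (onList F) (onList G) Y Z) l =
      sgn 𝕜 d e • unshuffleSum 𝕜 (crossTerm m e (onList G) (onList F) Y Z) l := by
    rw [← unshuffleSum_flip (crossTerm m e _ _ Y Z), ← unshuffleSum_smul]
    congr 1
    funext I J
    exact crossTerm_flip hcomm hF.2.2 hG.2.2 Y Z I J
  simp only [hr]
  rw [onList_ins_concat_mul hF.2.2 ((isMultilin_iff G).1 hG.1) ((isGradedSym_iff G).1 hG.2.1)
      hgr hF' hG',
    onList_ins_concat_mul hG.2.2 ((isMultilin_iff F).1 hF.1) ((isGradedSym_iff F).1 hF.2.1)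
      hgr hG' hF', hcross]
  simp only [map_sub, map_smul, LinearMap.sub_apply, LinearMap.smul_apply]
  module

theorem ins_listMultilin {F G : RawForm E} (hF : IsMultilin 𝕜 E F) (hG : IsMultilin 𝕜 E G) :
    ListMultilin 𝕜 (onList (ins 𝕜 E F G)) := by
  have hG := (isMultilin_iff G).1 hG
  rw [funext (onList_ins F G hG)]
  refine ListMultilin.unshuffleSum (fun J u w i a b c => ?_)
    fun I => insertLin_multilin hG (onList F I)
  obtain ⟨h1, h2⟩ := (isMultilin_iff F).1 hF u w i a b c
  simp only [h1, h2, map_add, map_smul, and_self]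

theorem ins_listSym {F G : RawForm E} (hF : IsGradedSym 𝕜 E F) (hG : IsMultilin 𝕜 E G)
    (hGs : IsGradedSym 𝕜 E G) : ListSym 𝕜 (onList (ins 𝕜 E F G)) := by
  have hG := (isMultilin_iff G).1 hG
  rw [funext (onList_ins F G hG)]
  refine ListSym.unshuffleSum (fun J u w x y => ?_)
    fun I => insertLin_sym hG ((isGradedSym_iff G).1 hGs) (onList F I)
  have h := (isGradedSym_iff F).1 hF u w x y
  simp only [h, map_smul]

end Bracket

/-- If `D_1` is a multi-derivation symmetric vector valued `d_1`-form and
`D_2` a multi-derivation symmetric vector valued `d_2`-form on a graded vector space equipped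
with a graded commutative associative algebra structure on `E[2]`, then `[D_1,D_2]_RN` is a
multi-derivation symmetric vector valued `(d_1+d_2-1)`-form; consequently multi-derivations
form a graded Lie subalgebra for the Richardson–Nijenhuis bracket. -/
theorem statement4 (𝕜 : Type) [Field 𝕜] [CharZero 𝕜]
    (E : ℤ → Type) [∀ i, AddCommGroup (E i)] [∀ i, Module 𝕜 (E i)]
    (mul : (⨁ i, E i) → (⨁ i, E i) → ⨁ i, E i)
    (hbil : IsMulBilin 𝕜 E mul) (hgr : IsMulGraded E mul)
    (hassoc : IsMulAssoc E mul) (hcomm : IsMulComm 𝕜 E mul)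
    (d1 d2 : ℕ) (δ1 δ2 : ℤ) (D1 D2 : RawForm E)
    (h1 : IsSVF 𝕜 E δ1 D1) (h1a : IsArity E d1 D1) (h1d : IsMultiDeriv 𝕜 E mul D1)
    (h2 : IsSVF 𝕜 E δ2 D2) (h2a : IsArity E d2 D2) (h2d : IsMultiDeriv 𝕜 E mul D2) :
    IsMultiDeriv 𝕜 E mul (rnb 𝕜 E δ1 δ2 D1 D2) ∧
      IsArity E (d1 + d2 - 1) (rnb 𝕜 E δ1 δ2 D1 D2) ∧
      IsMultilin 𝕜 E (rnb 𝕜 E δ1 δ2 D1 D2) ∧ IsGradedSym 𝕜 E (rnb 𝕜 E δ1 δ2 D1 D2) := by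
  have hcomm' : ∀ (i j : ℤ) (v : E i) (w : E j),
      mul (DirectSum.of E i v) (DirectSum.of E j w) =
        sgn 𝕜 i j • mul (DirectSum.of E j w) (DirectSum.of E i v) := fun i j v w => by
    have hs : (-1 : 𝕜) ^ ((i + 2) * (j + 2)) = sgn 𝕜 (i + 2) (j + 2) := rfl
    rw [hcomm, hs]
    simp [sgn_add_left, sgn_add_right, sgn_two_left, sgn_two_right]
  let m : (⨁ i, E i) →ₗ[𝕜] (⨁ i, E i) →ₗ[𝕜] ⨁ i, E i := LinearMap.mk₂ 𝕜 mul
    (fun a b c => (hbil a b c 0).1) (fun r a c => (hbil a a c r).2.2.1)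
    (fun c a b => (hbil a b c 0).2.1) (fun r c a => (hbil a a c r).2.2.2)
  have l12 := ins_listMultilin h1.1 h2.1
  have l21 := ins_listMultilin h2.1 h1.1
  have s12 := ins_listSym h1.2.1 h2.1 h2.2.1
  have s21 := ins_listSym h2.2.1 h1.1 h1.2.1
  have hr : ∀ l, onList (rnb 𝕜 E δ1 δ2 D1 D2) l =
      onList (ins 𝕜 E D1 D2) l - sgn 𝕜 δ1 δ2 • onList (ins 𝕜 E D2 D1) l := fun l => rfl
  refine ⟨?_, ?_, ?_, ?_⟩
  · rw [isMultiDeriv_iff] at h1d h2d ⊢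
    exact bracket_listDeriv (m := m) h1 h2 hgr hcomm' h1d h2d
  · intro n hn ι x
    rw [rnb, ins_isArity h1a h2a n hn, ins_isArity h2a h1a n (by omega), smul_zero, sub_zero]
  · rw [isMultilin_iff]
    intro u w i a b c
    simp only [hr, (l12 u w i a b c).1, (l12 u w i a b c).2, (l21 u w i a b c).1,
      (l21 u w i a b c).2]
    exact ⟨by module, by module⟩
  · rw [isGradedSym_iff]
    intro u w x y
    simp only [hr, s12 u w x y, s21 u w x y]
    module

end RN
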